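/- Let d ≥ 1 and let φ : ℕ → [0,∞) satisfy φ(0)=0, φ nondecreasing (condition (N)), the attractive condition (A): φ(l+m) ≤ φ(l)+φ(m), and the normalisation (SL): φ(n)/n → 0. Then the limiting log-moment generating function Λ satisfies Λ(h) = λ₀ for every h ∈ K_{λ₀}. Consequently, for every h in the interior of K_{λ₀}, Λ_h ≡ 0 in a neighbourhood of the origin, and there exists α = α(h) > 0 such that the rate function satisfies J_h(u) ≥ α‖u‖ for all u in a neighbourhood of 0; in particular the walk is sub-ballistic under P_n^h. -/

import Mathlib

open scoped BigOperators ENNReal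
open Filter Topology

noncomputable section

namespace SIRW

abbrev Pt (d : ℕ) := Fin d → ℤ

variable {d : ℕ}

/-- A step of a nearest-neighbour walk: a vector of ℓ¹-norm one. -/
def IsStep (s : Pt d) : Prop := (∑ i, |s i|) = 1

/-- A nearest-neighbour path started at the origin, encoded by its list of steps. -/
def IsPath (γ : List (Pt d)) : Prop := ∀ s ∈ γ, IsStep s

/-- Position of the path after `k` steps (the path starts at the origin). -/
def pos (γ : List (Pt d)) (k : ℕ) : Pt d := (γ.take k).sum

/-- Displacement `D(γ) = γ(n) - γ(0)`. -/
def disp (γ : List (Pt d)) : Pt d := γ.sum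

/-- Local time of the path at the site `x`. -/
def locTime (γ : List (Pt d)) (x : Pt d) : ℕ :=
  ((Finset.range (γ.length + 1)).filter (fun k => pos γ k = x)).card

/-- The (finite) set of sites visited by the path. -/
def visited (γ : List (Pt d)) : Finset (Pt d) :=
  (Finset.range (γ.length + 1)).image (pos γ)

/-- Site potential `Φ(γ) = ∑_x φ(l_x(γ))`, for `φ : ℕ → [0,∞]` with `φ 0 = 0`. -/
def PotE (φ : ℕ → ℝ≥0∞) (γ : List (Pt d)) : ℝ≥0∞ :=
  ∑ x ∈ visited γ, φ (locTime γ x)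

/-- Site potential `Φ(γ) = ∑_x φ(l_x(γ))`, for real-valued `φ` with `φ 0 = 0`. -/
def PotR (φ : ℕ → ℝ) (γ : List (Pt d)) : ℝ :=
  ∑ x ∈ visited γ, φ (locTime γ x)

/-- `e^{-a}` for `a ∈ [0,∞]`, with `e^{-∞} = 0`. -/
def expNegE (a : ℝ≥0∞) : ℝ≥0∞ :=
  if a = ⊤ then 0 else ENNReal.ofReal (Real.exp (-a.toReal))

/-- `e^{a}` for `a ∈ [0,∞]`, with `e^{∞} = ∞`. -/
def expE (a : ℝ≥0∞) : ℝ≥0∞ :=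
  if a = ⊤ then ⊤ else ENNReal.ofReal (Real.exp a.toReal)

/-- Weight `W_λ(γ) = e^{-Φ(γ) - λ|γ|}` (extended-real-valued potential). -/
def wE (φ : ℕ → ℝ≥0∞) (lam : ℝ) (γ : List (Pt d)) : ℝ≥0∞ :=
  expNegE (PotE φ γ) * ENNReal.ofReal (Real.exp (-(lam * γ.length)))

/-- Weight `W_λ(γ) = e^{-Φ(γ) - λ|γ|}` (real-valued potential). -/
def wR (φ : ℕ → ℝ) (lam : ℝ) (γ : List (Pt d)) : ℝ≥0∞ :=
  ENNReal.ofReal (Real.exp (-PotR φ γ - lam * γ.length))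

/-- The set of `n`-step nearest-neighbour paths started at the origin. -/
def PathsN (d n : ℕ) : Set (List (Pt d)) := {γ | IsPath γ ∧ γ.length = n}

/-- Partition function `Z_n` (extended-real-valued potential). -/
def ZE (d : ℕ) (φ : ℕ → ℝ≥0∞) (n : ℕ) : ℝ≥0∞ :=
  ∑' γ : PathsN d n, expNegE (PotE φ (γ : List (Pt d)))

/-- Partition function `Z_n` (real-valued potential). -/
def ZR (d : ℕ) (φ : ℕ → ℝ) (n : ℕ) : ℝ≥0∞ :=
  ∑' γ : PathsN d n, ENNReal.ofReal (Real.exp (-PotR φ (γ : List (Pt d))))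

/-- Paths from `0` to `x`. -/
def Dpaths (x : Pt d) : Set (List (Pt d)) := {γ | IsPath γ ∧ disp γ = x}

/-- Paths from `0` to `x` hitting `x` only at their final point. -/
def Hpaths (x : Pt d) : Set (List (Pt d)) := {γ | IsPath γ ∧ disp γ = x ∧ locTime γ x = 1}

/-- Two-point function `D_λ(x)` (extended-real-valued potential). -/
def DEf (φ : ℕ → ℝ≥0∞) (lam : ℝ) (x : Pt d) : ℝ≥0∞ :=
  ∑' γ : Dpaths x, wE φ lam (γ : List (Pt d))

/-- Two-point function `H_λ(x)` (extended-real-valued potential). -/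
def HEf (φ : ℕ → ℝ≥0∞) (lam : ℝ) (x : Pt d) : ℝ≥0∞ :=
  ∑' γ : Hpaths x, wE φ lam (γ : List (Pt d))

/-- Two-point function `D_λ(x)` (real-valued potential). -/
def DRf (φ : ℕ → ℝ) (lam : ℝ) (x : Pt d) : ℝ≥0∞ :=
  ∑' γ : Dpaths x, wR φ lam (γ : List (Pt d))

/-- Two-point function `H_λ(x)` (real-valued potential). -/
def HRf (φ : ℕ → ℝ) (lam : ℝ) (x : Pt d) : ℝ≥0∞ :=
  ∑' γ : Hpaths x, wR φ lam (γ : List (Pt d))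

/-- Coercion of a lattice point to a real vector. -/
def ctR (x : Pt d) : Fin d → ℝ := fun i => (x i : ℝ)

/-- Componentwise floor `⌊M x⌋`. -/
def flr (M : ℝ) (x : Fin d → ℝ) : Pt d := fun i => ⌊M * x i⌋

/-- Euclidean scalar product on `ℝ^d`. -/
def inr (h x : Fin d → ℝ) : ℝ := ∑ i, h i * x i

/-- Euclidean norm on `ℝ^d`. -/
def nrm (x : Fin d → ℝ) : ℝ := Real.sqrt (∑ i, x i ^ 2)

/-- Wulff shape `K = {h : (h,x) ≤ ξ(x) ∀x}` associated with a norm `ξ`. -/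
def Kset (ξ : (Fin d → ℝ) → ℝ) : Set (Fin d → ℝ) := {h | ∀ x, inr h x ≤ ξ x}

/-- Weight `W_h(γ) = e^{-Φ(γ) + (h, D(γ))}` (extended-real-valued potential). -/
def wHE (φ : ℕ → ℝ≥0∞) (h : Fin d → ℝ) (γ : List (Pt d)) : ℝ≥0∞ :=
  expNegE (PotE φ γ) * ENNReal.ofReal (Real.exp (inr h (ctR (disp γ))))

/-- Partition function `Z_n^h` with drift `h` (extended-real-valued potential). -/
def ZHE (d : ℕ) (φ : ℕ → ℝ≥0∞) (h : Fin d → ℝ) (n : ℕ) : ℝ≥0∞ :=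
  ∑' γ : PathsN d n, wHE φ h (γ : List (Pt d))

/-- Weight `W_h(γ) = e^{-Φ(γ) + (h, D(γ))}` (real-valued potential). -/
def wHR (φ : ℕ → ℝ) (h : Fin d → ℝ) (γ : List (Pt d)) : ℝ≥0∞ :=
  ENNReal.ofReal (Real.exp (-PotR φ γ + inr h (ctR (disp γ))))

/-- Partition function `Z_n^h` with drift `h` (real-valued potential). -/
def ZHR (d : ℕ) (φ : ℕ → ℝ) (h : Fin d → ℝ) (n : ℕ) : ℝ≥0∞ :=
  ∑' γ : PathsN d n, wHR φ h (γ : List (Pt d))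

/-- Condition (SL) for an extended-real-valued potential: finiteness and sublinearity. -/
def SLE (φ : ℕ → ℝ≥0∞) : Prop :=
  (∀ n, φ n ≠ ⊤) ∧ Tendsto (fun n : ℕ => (φ n).toReal / n) atTop (𝓝 0)

/-- Forward cone `Y^>_δ(h) = {y : s_h(y) < δ ξ(y)}`, where `s_h(y) = ξ(y) - (h,y)`. -/
def Ygt (ξ : (Fin d → ℝ) → ℝ) (h : Fin d → ℝ) (δ : ℝ) : Set (Pt d) :=
  {y | ξ (ctR y) - inr h (ctR y) < δ * ξ (ctR y)}

/-- `γ(k)` is an `(h,δ)`-cone point of `γ`: the whole path lies in the union of the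
forward and backward cones of aperture `3δ` centred at `γ(k)`. -/
def IsConePt (ξ : (Fin d → ℝ) → ℝ) (h : Fin d → ℝ) (δ : ℝ) (γ : List (Pt d)) (k : ℕ) : Prop :=
  k ≤ γ.length ∧ ∀ j ≤ γ.length, j ≠ k →
    ((pos γ j - pos γ k) ∈ Ygt ξ h (3 * δ) ∨ (pos γ k - pos γ j) ∈ Ygt ξ h (3 * δ))

open scoped Classical in
/-- The number of `(h,δ)`-cone points of the path `γ`. -/
def coneCount (ξ : (Fin d → ℝ) → ℝ) (h : Fin d → ℝ) (δ : ℝ) (γ : List (Pt d)) : ℕ :=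
  ((Finset.range (γ.length + 1)).filter (fun k => IsConePt ξ h δ γ k)).card

/-- Unoriented edges traversed by the path `γ` started at the point `a`. -/
def pathEdges (a : Pt d) (γ : List (Pt d)) : Set (Sym2 (Pt d)) :=
  {e | ∃ k < γ.length, e = s(a + pos γ k, a + pos γ (k + 1))}

/-- Starting point of the `i`-th piece in the concatenation of the paths `γv 0, …, γv (m-1)`. -/
def famStart {m : ℕ} (γv : Fin m → List (Pt d)) (i : Fin m) : Pt d :=
  ∑ j ∈ Finset.univ.filter (fun j : Fin m => j < i), disp (γv j)

/-- The pieces `γv 0, …, γv (m-1)` of a concatenation are edge-disjoint. -/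
def EdgeDisjointFam {m : ℕ} (γv : Fin m → List (Pt d)) : Prop :=
  ∀ i j : Fin m, i ≠ j →
    Disjoint (pathEdges (famStart γv i) (γv i)) (pathEdges (famStart γv j) (γv j))

/-- Concatenation `γ₁ ∪ ⋯ ∪ γ_m` of paths (as step lists). -/
def concatFam {m : ℕ} (γv : Fin m → List (Pt d)) : List (Pt d) := (List.ofFn γv).flatten

/-- Perturbed weight `e^{-Φ(γ) - R(γ,g) + (g, D(γ))}`. -/
def wPert (φ : ℕ → ℝ≥0∞) (Rp : List (Pt d) → (Fin d → ℝ) → ℝ) (g : Fin d → ℝ)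
    (γ : List (Pt d)) : ℝ≥0∞ :=
  expNegE (PotE φ γ) * ENNReal.ofReal (Real.exp (-Rp γ g + inr g (ctR (disp γ))))

/-- Perturbed partition function `Z̃_n^g`. -/
def ZPert (d : ℕ) (φ : ℕ → ℝ≥0∞) (Rp : List (Pt d) → (Fin d → ℝ) → ℝ)
    (g : Fin d → ℝ) (n : ℕ) : ℝ≥0∞ :=
  ∑' γ : PathsN d n, wPert φ Rp g (γ : List (Pt d))

/-- The segment of `γ` of length `p` started at time `l` matches the pattern
`(u 0, …, u p)` up to a shift. -/
def patMatch (u : ℕ → Pt d) (p : ℕ) (γ : List (Pt d)) (l : ℕ) : Prop :=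
  ∀ j ≤ p, pos γ (l + j) - pos γ l = u j - u 0

open scoped Classical in
/-- Number of occurrences `N_η(γ)` of the pattern `η = (u 0, …, u p)` in `γ`. -/
def Npat (u : ℕ → Pt d) (p : ℕ) (γ : List (Pt d)) : ℕ :=
  ((Finset.range (γ.length + 1 - p)).filter (fun l => patMatch u p γ l)).card

/-- The gradient vector of `f : ℝ^d → ℝ` at `g`. -/
def gradVec (f : (Fin d → ℝ) → ℝ) (g : Fin d → ℝ) : Fin d → ℝ :=
  fun i => fderiv ℝ f g (Pi.single i 1)

end SIRW

open SIRW


namespace SIRWaux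

variable {d : ℕ}

lemma pos_append_le (a b : List (Pt d)) {k : ℕ} (hk : k ≤ a.length) :
    pos (a ++ b) k = pos a k := by
  unfold pos
  rw [List.take_append_of_le_length hk]

lemma pos_append_add (a b : List (Pt d)) (j : ℕ) :
    pos (a ++ b) (a.length + j) = disp a + pos b j := by
  unfold pos disp
  rw [List.take_length_add_append, List.sum_append]

lemma pos_zero (a : List (Pt d)) : pos a 0 = 0 := by simp [pos]

lemma pos_length (a : List (Pt d)) : pos a a.length = disp a := by simp [pos, disp]

lemma locTime_append (a b : List (Pt d)) (x : Pt d) :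
    locTime (a ++ b) x ≤ locTime a x + locTime b (x - disp a) := by
  unfold locTime
  have hsub : (Finset.range ((a ++ b).length + 1)).filter (fun k => pos (a ++ b) k = x) ⊆
      (Finset.range (a.length + 1)).filter (fun k => pos a k = x) ∪
      ((Finset.range (b.length + 1)).filter (fun k => pos b k = x - disp a)).image
        (fun k => a.length + k) := by
    intro k hk
    simp only [Finset.mem_filter, Finset.mem_range, List.length_append, Finset.mem_union,
      Finset.mem_image] at hk ⊢
    by_cases h : k ≤ a.length
    · left
      exact ⟨by omega, by rw [← pos_append_le a b h]; exact hk.2⟩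
    · right
      obtain ⟨j, rfl⟩ := Nat.exists_eq_add_of_le (le_of_not_ge h)
      refine ⟨j, ⟨by omega, ?_⟩, rfl⟩
      rw [← hk.2, pos_append_add]; abel
  exact (Finset.card_le_card hsub).trans
    ((Finset.card_union_le _ _).trans (Nat.add_le_add_left Finset.card_image_le _))

lemma locTime_eq_zero (a : List (Pt d)) (x : Pt d) (hx : x ∉ visited a) : locTime a x = 0 := by
  unfold locTime
  rw [Finset.card_eq_zero, Finset.filter_eq_empty_iff]
  intro k hk h
  exact hx (Finset.mem_image.2 ⟨k, hk, h⟩)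

lemma PotR_eq (φ : ℕ → ℝ) (hN0 : φ 0 = 0) (a : List (Pt d)) (S : Finset (Pt d))
    (hS : visited a ⊆ S) : PotR φ a = ∑ x ∈ S, φ (locTime a x) := by
  unfold PotR
  apply Finset.sum_subset hS
  intro x _ hx
  rw [locTime_eq_zero a x hx, hN0]

lemma PotR_append (φ : ℕ → ℝ) (hN0 : φ 0 = 0) (hm : Monotone φ)
    (hA : ∀ l m : ℕ, φ (l + m) ≤ φ l + φ m) (a b : List (Pt d)) :
    PotR φ (a ++ b) ≤ PotR φ a + PotR φ b := by
  set S := visited (a ++ b) ∪ visited a ∪ (visited b).image (fun y => y + disp a) with hS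
  have hb : PotR φ b = ∑ x ∈ S, φ (locTime b (x - disp a)) := by
    rw [PotR_eq φ hN0 b (S.image (fun x => x - disp a)), Finset.sum_image]
    · intro x _ y _ hxy
      simpa using hxy
    · intro y hy
      refine Finset.mem_image.2 ⟨y + disp a, ?_, by simp⟩
      exact Finset.mem_union_right _ (Finset.mem_image_of_mem _ hy)
  rw [hb, PotR_eq φ hN0 (a ++ b) S (by intro x hx; simp [hS, hx]),
    PotR_eq φ hN0 a S (by intro x hx; simp [hS, hx]), ← Finset.sum_add_distrib]
  exact Finset.sum_le_sum fun x _ => (hm (locTime_append a b x)).trans (hA _ _)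

lemma PotR_le (φ : ℕ → ℝ) (hN0 : φ 0 = 0) (hA : ∀ l m : ℕ, φ (l + m) ≤ φ l + φ m)
    (a : List (Pt d)) : PotR φ a ≤ φ 1 * (a.length + 1) := by
  have h1 : ∀ n : ℕ, φ n ≤ n * φ 1 := by
    intro n
    induction n with
    | zero => simp [hN0]
    | succ n ih => push_cast; linarith [hA n 1]
  have h2 : a.length + 1 = ∑ x ∈ visited a, locTime a x := by
    have := Finset.card_eq_sum_card_image (pos a) (Finset.range (a.length + 1))
    simpa [visited, locTime] using this
  have h3 : ((a.length : ℝ) + 1) = ∑ x ∈ visited a, (locTime a x : ℝ) := by exact_mod_cast h2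
  rw [h3, Finset.mul_sum]
  exact Finset.sum_le_sum fun x _ => by linarith [h1 (locTime a x)]

lemma map_neg_sum (a : List (Pt d)) : (a.map (fun s => -s)).sum = -a.sum := by
  induction a with
  | nil => simp
  | cons s a ih => simp [ih]; abel

lemma pos_neg (a : List (Pt d)) (k : ℕ) : pos (a.map (fun s => -s)) k = -pos a k := by
  unfold pos
  rw [← List.map_take, map_neg_sum]

lemma PotR_neg (φ : ℕ → ℝ) (a : List (Pt d)) : PotR φ (a.map (fun s => -s)) = PotR φ a := by
  unfold PotR
  have hv : visited (a.map (fun s => -s)) = (visited a).image (fun x => -x) := by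
    unfold visited
    rw [Finset.image_image, List.length_map]
    exact Finset.image_congr (fun k _ => pos_neg a k)
  have hl : ∀ x, locTime (a.map (fun s => -s)) (-x) = locTime a x := by
    intro x
    unfold locTime
    simp only [List.length_map, pos_neg, neg_inj]
  rw [hv, Finset.sum_image (fun x _ y _ h => neg_injective h)]
  simp only [hl]

lemma wR_append (φ : ℕ → ℝ) (hN0 : φ 0 = 0) (hm : Monotone φ)
    (hA : ∀ l m : ℕ, φ (l + m) ≤ φ l + φ m) (lam : ℝ) (a b : List (Pt d)) :
    wR φ lam a * wR φ lam b ≤ wR φ lam (a ++ b) := by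
  unfold wR
  rw [← ENNReal.ofReal_mul (Real.exp_nonneg _), ← Real.exp_add]
  apply ENNReal.ofReal_le_ofReal
  apply Real.exp_le_exp.2
  have := PotR_append φ hN0 hm hA a b
  rw [List.length_append]
  push_cast
  linarith

/-- Total weight of a set of paths. -/
def TW (φ : ℕ → ℝ) (lam : ℝ) (A : Set (List (Pt d))) : ℝ≥0∞ := ∑' γ : A, wR φ lam (γ : List (Pt d))

lemma TW_mul_le (φ : ℕ → ℝ) (hN0 : φ 0 = 0) (hm : Monotone φ)
    (hA : ∀ l m : ℕ, φ (l + m) ≤ φ l + φ m) (lam : ℝ) (A B C : Set (List (Pt d))) (p : ℕ)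
    (hp : ∀ a ∈ A, a.length = p) (hC : ∀ a ∈ A, ∀ b ∈ B, a ++ b ∈ C) :
    TW φ lam A * TW φ lam B ≤ TW φ lam C := by
  unfold TW
  rw [← ENNReal.tsum_mul_right]
  simp_rw [← ENNReal.tsum_mul_left]
  rw [← ENNReal.tsum_prod]
  let F : A × B → C := fun q => ⟨q.1.1 ++ q.2.1, hC _ q.1.2 _ q.2.2⟩
  have hF : Function.Injective F := by
    rintro ⟨⟨a, ha⟩, ⟨b, hb⟩⟩ ⟨⟨a', ha'⟩, ⟨b', hb'⟩⟩ h
    have h' : a ++ b = a' ++ b' := congrArg Subtype.val h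
    obtain ⟨h1, h2⟩ := List.append_inj h' (by rw [hp a ha, hp a' ha'])
    subst h1; subst h2; rfl
  calc _ ≤ ∑' q : A × B, wR φ lam ((F q : C) : List (Pt d)) :=
        ENNReal.tsum_le_tsum fun q => wR_append φ hN0 hm hA lam _ _
    _ ≤ _ := ENNReal.tsum_comp_le_tsum_of_injective hF (fun c : C => wR φ lam (c : List (Pt d)))

/-- Integer inner product with `x`. -/
def fx (x : Pt d) : Pt d →+ ℤ where
  toFun y := ∑ i, x i * y i
  map_zero' := by simp
  map_add' y z := by simp [mul_add, Finset.sum_add_distrib]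

/-- paths of length `n` ending at `x` -/
def Blk (n : ℕ) (x : Pt d) : Set (List (Pt d)) := {γ | IsPath γ ∧ γ.length = n ∧ disp γ = x}

/-- `m`-fold concatenations. -/
def Sm (n : ℕ) (x : Pt d) (L : ℤ) (m : ℕ) : Set (List (Pt d)) :=
  {γ | IsPath γ ∧ γ.length = m * n ∧ disp γ = m • x ∧
    ∀ k ≤ γ.length, fx x (pos γ k) ≤ m * fx x x + L}

lemma fx_apply (x y : Pt d) : fx x y = ∑ i, x i * y i := rfl

lemma fx_self_nonneg (x : Pt d) : 0 ≤ fx x x := by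
  rw [fx_apply]
  exact Finset.sum_nonneg fun i _ => mul_self_nonneg _

lemma fx_self_pos (x : Pt d) (hx : x ≠ 0) : 0 < fx x x := by
  obtain ⟨i, hi⟩ := Function.ne_iff.1 hx
  exact Finset.sum_pos' (fun i _ => mul_self_nonneg _) ⟨i, Finset.mem_univ _, mul_self_pos.2 hi⟩

lemma fx_step (x s : Pt d) (hs : IsStep s) : fx x s ≤ ∑ i, |x i| := by
  have hs' : ∀ i, |s i| ≤ 1 := by
    intro i
    rw [← hs]
    exact Finset.single_le_sum (f := fun i => |s i|) (fun i _ => abs_nonneg _) (Finset.mem_univ i)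
  rw [fx_apply]
  apply Finset.sum_le_sum
  intro i _
  calc x i * s i ≤ |x i * s i| := le_abs_self _
    _ = |x i| * |s i| := abs_mul _ _
    _ ≤ |x i| * 1 := mul_le_mul_of_nonneg_left (hs' i) (abs_nonneg _)
    _ = |x i| := mul_one _

lemma fx_sum (x : Pt d) (γ : List (Pt d)) (h : IsPath γ) :
    fx x γ.sum ≤ γ.length * ∑ i, |x i| := by
  induction γ with
  | nil => simp
  | cons s γ ih =>
    rw [List.sum_cons, map_add, List.length_cons]
    have h1 := fx_step x s (h s (by simp))
    have h2 := ih (fun t ht => h t (by simp [ht]))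
    push_cast
    linarith

lemma fx_pos (x : Pt d) (γ : List (Pt d)) (h : IsPath γ) (k : ℕ) :
    fx x (pos γ k) ≤ γ.length * ∑ i, |x i| := by
  have := fx_sum x (γ.take k) (fun s hs => h s (List.mem_of_mem_take hs))
  refine this.trans ?_
  apply mul_le_mul_of_nonneg_right _ (Finset.sum_nonneg fun i _ => abs_nonneg _)
  rw [List.length_take]
  exact_mod_cast min_le_right _ _

lemma Sm_pow (φ : ℕ → ℝ) (hN0 : φ 0 = 0) (hm : Monotone φ)
    (hA : ∀ l m : ℕ, φ (l + m) ≤ φ l + φ m) (lam : ℝ) (n : ℕ) (x : Pt d) (m : ℕ) :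
    TW φ lam (Sm n x (n * ∑ i, |x i|) 0) * (TW φ lam (Blk n x)) ^ m
      ≤ TW φ lam (Sm n x (n * ∑ i, |x i|) m) := by
  induction m with
  | zero => simp
  | succ m ih =>
    rw [pow_succ, ← mul_assoc]
    refine (mul_le_mul_left ih _).trans ?_
    refine TW_mul_le φ hN0 hm hA lam _ _ _ (m * n) (fun a ha => ha.2.1) ?_
    rintro a ⟨ha1, ha2, ha3, ha4⟩ b ⟨hb1, hb2, hb3⟩
    refine ⟨?_, ?_, ?_, ?_⟩
    · intro s hs
      rcases List.mem_append.1 hs with hs | hs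
      · exact ha1 s hs
      · exact hb1 s hs
    · rw [List.length_append, ha2, hb2]; ring
    · unfold disp at *
      rw [List.sum_append, ha3, hb3, succ_nsmul]
    · intro k hk
      have hnn := fx_self_nonneg x
      by_cases h : k ≤ a.length
      · rw [pos_append_le a b h]
        have := ha4 k h
        push_cast
        linarith
      · obtain ⟨j, rfl⟩ := Nat.exists_eq_add_of_le (le_of_not_ge h)
        rw [pos_append_add, map_add, ha3, map_nsmul, nsmul_eq_mul]
        have := fx_pos x b hb1 j
        rw [hb2] at this
        push_cast
        linarith

lemma nil_mem_Sm (n : ℕ) (x : Pt d) : ([] : List (Pt d)) ∈ Sm n x (n * ∑ i, |x i|) 0 := by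
  refine ⟨by simp [IsPath], by simp, by simp [disp], ?_⟩
  intro k _
  simp only [pos, List.take_nil, List.sum_nil, map_zero]
  have : 0 ≤ ∑ i, |x i| := Finset.sum_nonneg fun i _ => abs_nonneg _
  have h2 : 0 ≤ (n : ℤ) * ∑ i, |x i| := by positivity
  simpa using h2

lemma wR_le_TW (φ : ℕ → ℝ) (lam : ℝ) (A : Set (List (Pt d))) (a : List (Pt d)) (ha : a ∈ A) :
    wR φ lam a ≤ TW φ lam A :=
  ENNReal.le_tsum (f := fun γ : A => wR φ lam (γ : List (Pt d))) ⟨a, ha⟩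

/-- The monotone geodesic. -/
lemma exists_geo (x y : Pt d) (hxy : ∀ i, x i * y i = 0 → y i = 0) (hnn : ∀ i, 0 ≤ x i * y i) :
    ∃ η : List (Pt d), IsPath η ∧ disp η = y ∧ ∀ s ∈ η, 0 < fx x s := by
  refine ⟨(List.finRange d).flatMap fun i =>
    List.replicate (y i).natAbs (Pi.single i (y i).sign), ?_, ?_, ?_⟩
  · intro s hs
    simp only [List.mem_flatMap, List.mem_replicate] at hs
    obtain ⟨i, _, hne, rfl⟩ := hs
    unfold IsStep
    rw [Finset.sum_eq_single i]
    · simp only [Pi.single_eq_same]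
      have : y i ≠ 0 := by simpa using hne
      rcases lt_or_gt_of_ne this with h | h
      · rw [Int.sign_eq_neg_one_of_neg h]; rfl
      · rw [Int.sign_eq_one_of_pos h]; rfl
    · intro j _ hj
      rw [Pi.single_eq_of_ne hj]; rfl
    · simp
  · unfold disp
    rw [List.flatMap, List.sum_flatten, List.map_map]
    have : (List.sum ∘ fun i => List.replicate (y i).natAbs (Pi.single i (y i).sign : Pt d))
        = fun i => (Pi.single i (y i) : Pt d) := by
      funext i
      simp only [Function.comp_apply, List.sum_replicate]
      rw [← Pi.single_smul]
      congr 1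
      rw [nsmul_eq_mul, mul_comm]
      exact Int.sign_mul_natAbs (y i)
    rw [this, ← List.ofFn_eq_map, List.sum_ofFn, Finset.univ_sum_single]
  · intro s hs
    simp only [List.mem_flatMap, List.mem_replicate] at hs
    obtain ⟨i, _, hne, rfl⟩ := hs
    have hy : y i ≠ 0 := by simpa using hne
    have hp : 0 < x i * y i := lt_of_le_of_ne (hnn i) (fun h => hy (hxy i h.symm))
    have : fx x (Pi.single i (y i).sign) = x i * (y i).sign := by
      change ∑ j, x j * (Pi.single i (y i).sign : Pt d) j = _
      rw [Finset.sum_eq_single i]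
      · simp
      · intro j _ hj
        rw [Pi.single_eq_of_ne hj]; simp
      · simp
    rw [this]
    rcases lt_or_gt_of_ne hy with h | h
    · rw [Int.sign_eq_neg_one_of_neg h]; nlinarith
    · rw [Int.sign_eq_one_of_pos h]; nlinarith

lemma fx_sum_pos (x : Pt d) (η : List (Pt d)) (h : ∀ s ∈ η, 0 < fx x s) (hne : η ≠ []) :
    0 < fx x η.sum := by
  induction η with
  | nil => exact absurd rfl hne
  | cons s η ih =>
    rw [List.sum_cons, map_add]
    have h1 := h s (by simp)
    by_cases he : η = []
    · subst he; simpa using h1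
    · have := ih (fun t ht => h t (by simp [ht])) he
      linarith

lemma fx_pos_lt (x : Pt d) (η : List (Pt d)) (h : ∀ s ∈ η, 0 < fx x s) (k : ℕ)
    (hk : k < η.length) : fx x (pos η k) < fx x (disp η) := by
  have h1 : disp η = pos η k + (η.drop k).sum := by
    unfold disp pos
    rw [← List.sum_append, List.take_append_drop]
  rw [h1, map_add]
  have := fx_sum_pos x (η.drop k) (fun s hs => h s (List.mem_of_mem_drop hs))
    (by simpa using hk)
  linarith

/-- Key lower bound on `H`. -/
lemma H_lower (φ : ℕ → ℝ) (hN0 : φ 0 = 0) (hm : Monotone φ)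
    (hA : ∀ l m : ℕ, φ (l + m) ≤ φ l + φ m) (lam : ℝ) (n : ℕ) (x : Pt d) (hx : x ≠ 0) :
    ∃ K : ℕ, ∃ c : ℝ, 0 < c ∧ ∀ m : ℕ,
      ENNReal.ofReal c * (TW φ lam (Blk n x)) ^ m ≤ HRf φ lam ((m + K) • x) := by
  set L : ℤ := n * ∑ i, |x i| with hL
  have hL0 : 0 ≤ L := by
    have : 0 ≤ ∑ i, |x i| := Finset.sum_nonneg fun i _ => abs_nonneg _
    positivity
  set K : ℕ := L.toNat + 1 with hK
  have hKL : L < K := by push_cast [hK]; omega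
  have hpos := fx_self_pos x hx
  obtain ⟨η, h1, h2, h3⟩ := exists_geo x (K • x)
    (by intro i h
        simp only [Pi.smul_apply, nsmul_eq_mul] at h ⊢
        rcases mul_eq_zero.1 h with h | h
        · rw [h]; simp
        · exact h)
    (by intro i
        simp only [Pi.smul_apply, nsmul_eq_mul]
        have := mul_self_nonneg (x i)
        have hK0 : (0 : ℤ) ≤ K := by positivity
        calc (0 : ℤ) ≤ K * (x i * x i) := mul_nonneg hK0 this
          _ = _ := by ring)
  have hw : ∀ a : List (Pt d), wR φ lam a = ENNReal.ofReal (Real.exp (-PotR φ a - lam * a.length)) :=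
    fun a => rfl
  refine ⟨K, Real.exp (-PotR φ ([] : List (Pt d)) - lam * ([] : List (Pt d)).length) *
    Real.exp (-PotR φ η - lam * η.length), by positivity, fun m => ?_⟩
  rw [ENNReal.ofReal_mul (Real.exp_nonneg _), ← hw, ← hw]
  have hH : HRf φ lam ((m + K) • x) = TW φ lam (Hpaths ((m + K) • x)) := rfl
  have step1 : wR φ lam ([] : List (Pt d)) * (TW φ lam (Blk n x)) ^ m ≤ TW φ lam (Sm n x L m) :=
    (mul_le_mul_left (wR_le_TW φ lam _ _ (nil_mem_Sm n x)) _).trans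
      (Sm_pow φ hN0 hm hA lam n x m)
  calc wR φ lam [] * wR φ lam η * TW φ lam (Blk n x) ^ m
      = (wR φ lam [] * TW φ lam (Blk n x) ^ m) * wR φ lam η := by ring
    _ ≤ TW φ lam (Sm n x L m) * TW φ lam {η} :=
        mul_le_mul' step1 (wR_le_TW φ lam _ _ rfl)
    _ ≤ HRf φ lam ((m + K) • x) := by
        rw [hH]
        refine TW_mul_le φ hN0 hm hA lam _ _ _ (m * n) (fun a ha => ha.2.1) ?_
        rintro a ⟨ha1, ha2, ha3, ha4⟩ b hb
        obtain rfl : b = η := hb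
        have hd : disp (a ++ b) = (m + K) • x := by
          rw [add_smul, ← ha3, ← h2]
          simp [disp]
        refine ⟨?_, hd, ?_⟩
        · intro s hs
          rcases List.mem_append.1 hs with hs | hs
          · exact ha1 s hs
          · exact h1 s hs
        · unfold locTime
          rw [Finset.card_eq_one]
          refine ⟨(a ++ b).length, ?_⟩
          ext k
          simp only [Finset.mem_filter, Finset.mem_range, Finset.mem_singleton]
          constructor
          · rintro ⟨hk, hkx⟩
            by_contra hne
            have hlt : k < (a ++ b).length := by omega
            have hv : fx x (pos (a ++ b) k) = (m + K : ℤ) * fx x x := by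
              rw [hkx, map_nsmul, nsmul_eq_mul]; push_cast; rfl
            by_cases h : k ≤ a.length
            · rw [pos_append_le a b h] at hv
              have := ha4 k h
              have hK1 : (K : ℤ) ≤ K * fx x x := by
                have hK0 : (0 : ℤ) ≤ K := by positivity
                nlinarith
              nlinarith
            · obtain ⟨j, rfl⟩ := Nat.exists_eq_add_of_le (le_of_not_ge h)
              rw [pos_append_add, map_add, ha3, map_nsmul, nsmul_eq_mul] at hv
              rw [List.length_append] at hlt
              have := fx_pos_lt x b h3 j (by omega)
              rw [h2, map_nsmul, nsmul_eq_mul] at this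
              nlinarith
          · rintro rfl
            exact ⟨by omega, by rw [pos_length, hd]⟩

end SIRWaux

namespace SIRWaux

variable {d : ℕ}

lemma step_finite : {s : Pt d | IsStep s}.Finite := by
  apply (Set.finite_Icc (fun _ => (-1 : ℤ) : Pt d) (fun _ => 1)).subset
  intro s hs
  have hs' : ∀ i, |s i| ≤ 1 := by
    intro i
    rw [← show (∑ i, |s i|) = 1 from hs]
    exact Finset.single_le_sum (f := fun i => |s i|) (fun i _ => abs_nonneg _) (Finset.mem_univ i)
  exact ⟨fun i => (abs_le.1 (hs' i)).1, fun i => (abs_le.1 (hs' i)).2⟩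

lemma PathsN_finite (n : ℕ) : (PathsN d n).Finite := by
  induction n with
  | zero =>
    apply (Set.finite_singleton ([] : List (Pt d))).subset
    rintro γ ⟨_, h⟩
    exact List.length_eq_zero_iff.1 h
  | succ n ih =>
    apply (Set.Finite.image2 (fun (s : Pt d) (γ : List (Pt d)) => s :: γ)
      (step_finite (d := d)) ih).subset
    rintro γ ⟨h1, h2⟩
    cases γ with
    | nil => simp at h2
    | cons s γ =>
      exact ⟨s, h1 s (by simp), γ, ⟨fun t ht => h1 t (by simp [ht]), by simpa using h2⟩, rfl⟩

lemma TW_PathsN_lt_top (φ : ℕ → ℝ) (lam : ℝ) (n : ℕ) : TW φ lam (PathsN d n) ≠ ⊤ := by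
  have := (PathsN_finite (d := d) n).fintype
  unfold TW
  rw [tsum_fintype]
  exact ENNReal.sum_ne_top.2 fun γ _ => ENNReal.ofReal_ne_top

lemma TW_PathsN (φ : ℕ → ℝ) (lam : ℝ) (n : ℕ) :
    TW φ lam (PathsN d n) = ENNReal.ofReal (Real.exp (-(lam * n))) * ZR d φ n := by
  unfold TW ZR
  rw [← ENNReal.tsum_mul_left]
  congr 1
  funext γ
  unfold wR
  rw [← ENNReal.ofReal_mul (Real.exp_nonneg _), ← Real.exp_add, γ.2.2]
  congr 2
  ring

lemma ZR_ne_top (φ : ℕ → ℝ) (n : ℕ) : ZR d φ n ≠ ⊤ := by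
  have := TW_PathsN_lt_top (d := d) φ 0 n
  rw [TW_PathsN] at this
  simpa using this

lemma rep_mem (n : ℕ) (i : Fin d) (ε : ℤ) (hε : |ε| = 1) :
    List.replicate n (Pi.single i ε : Pt d) ∈ PathsN d n := by
  refine ⟨?_, by simp⟩
  intro s hs
  obtain ⟨_, rfl⟩ := List.mem_replicate.1 hs
  unfold IsStep
  rw [Finset.sum_eq_single i]
  · simpa using hε
  · intro j _ hj
    rw [Pi.single_eq_of_ne hj]; rfl
  · simp

lemma ZR_pos (hd : 1 ≤ d) (φ : ℕ → ℝ) (n : ℕ) : 0 < ZR d φ n := by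
  have hm := rep_mem n (⟨0, hd⟩ : Fin d) 1 (by simp)
  refine lt_of_lt_of_le ?_ (ENNReal.le_tsum (f := fun γ : PathsN d n =>
    ENNReal.ofReal (Real.exp (-PotR φ (γ : List (Pt d))))) ⟨_, hm⟩)
  simp [Real.exp_pos]

lemma ZHR_ne_top (φ : ℕ → ℝ) (h : Fin d → ℝ) (n : ℕ) : ZHR d φ h n ≠ ⊤ := by
  have := (PathsN_finite (d := d) n).fintype
  unfold ZHR
  rw [tsum_fintype]
  exact ENNReal.sum_ne_top.2 fun γ _ => ENNReal.ofReal_ne_top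

lemma H_ne_top (hd : 1 ≤ d) (φ : ℕ → ℝ) (lam0 lam : ℝ) (hl : lam0 < lam)
    (hlam0 : Filter.Tendsto (fun n : ℕ => Real.log (ZR d φ n).toReal / n) Filter.atTop
      (nhds lam0)) (x : Pt d) : HRf φ lam x ≠ ⊤ := by
  have hsub : Hpaths x ⊆ ⋃ n, PathsN d n := by
    intro γ hγ
    exact Set.mem_iUnion.2 ⟨γ.length, hγ.1, rfl⟩
  have h1 : HRf φ lam x ≤ ∑' n, TW φ lam (PathsN d n) :=
    (ENNReal.tsum_mono_subtype (wR φ lam) hsub).trans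
      (ENNReal.tsum_iUnion_le_tsum (wR φ lam) (fun n => PathsN d n))
  refine ne_top_of_le_ne_top ?_ h1
  have h2 : ∀ n, TW φ lam (PathsN d n) =
      ENNReal.ofReal (Real.exp (-(lam * n)) * (ZR d φ n).toReal) := by
    intro n
    rw [TW_PathsN, ENNReal.ofReal_mul (Real.exp_nonneg _), ENNReal.ofReal_toReal (ZR_ne_top φ n)]
  simp_rw [h2]
  obtain ⟨mid, hm1, hm2⟩ := exists_between hl
  have hev : ∀ᶠ n : ℕ in atTop, ‖Real.exp (-(lam * n)) * (ZR d φ n).toReal‖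
      ≤ (Real.exp (mid - lam)) ^ n := by
    filter_upwards [hlam0.eventually (gt_mem_nhds hm1), eventually_gt_atTop 0] with n hn hn0
    have hn0' : (0 : ℝ) < n := by exact_mod_cast hn0
    rw [div_lt_iff₀ hn0'] at hn
    have hZ : 0 < (ZR d φ n).toReal := ENNReal.toReal_pos (ZR_pos hd φ n).ne' (ZR_ne_top φ n)
    have hZ2 := (Real.log_le_iff_le_exp hZ).1 hn.le
    rw [Real.norm_of_nonneg (by positivity), ← Real.exp_nat_mul]
    calc _ ≤ Real.exp (-(lam * n)) * Real.exp (mid * n) :=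
          mul_le_mul_of_nonneg_left hZ2 (Real.exp_nonneg _)
      _ = _ := by rw [← Real.exp_add]; congr 1; ring
  have hs : Summable fun n : ℕ => Real.exp (-(lam * n)) * (ZR d φ n).toReal :=
    Summable.of_norm_bounded_eventually_nat
      (summable_geometric_of_lt_one (Real.exp_nonneg _) (by
        rw [Real.exp_lt_one_iff]; linarith)) hev
  rw [← ENNReal.ofReal_tsum_of_nonneg (fun n => by positivity) hs]
  exact ENNReal.ofReal_ne_top

lemma Blk_ne_top (φ : ℕ → ℝ) (lam : ℝ) (n : ℕ) (x : Pt d) : TW φ lam (Blk n x) ≠ ⊤ :=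
  ne_top_of_le_ne_top (TW_PathsN_lt_top φ lam n)
    (ENNReal.tsum_mono_subtype (wR φ lam) (fun _ h => ⟨h.1, h.2.1⟩))

lemma tends_aux (c b : ℝ) (K : ℕ) :
    Tendsto (fun m : ℕ => -(c + m * b) / ((m + K : ℕ) : ℝ)) atTop (𝓝 (-b)) := by
  have h1 : Tendsto (fun m : ℕ => (-c + K * b) / ((m + K : ℕ) : ℝ) + -b) atTop (𝓝 (0 + -b)) := by
    apply Tendsto.add_const
    apply Tendsto.div_atTop tendsto_const_nhds
    exact tendsto_natCast_atTop_atTop.comp (tendsto_add_atTop_nat K)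
  rw [zero_add] at h1
  refine h1.congr' ?_
  filter_upwards [eventually_gt_atTop 0] with m hm
  have : ((m + K : ℕ) : ℝ) ≠ 0 := by positivity
  field_simp
  push_cast
  ring

lemma flr_nat (M : ℕ) (x : Pt d) : flr (M : ℝ) (ctR x) = M • x := by
  funext i
  simp only [flr, ctR, Pi.smul_apply, nsmul_eq_mul]
  rw [show (M : ℝ) * (x i : ℝ) = (((M : ℤ) * x i : ℤ) : ℝ) by push_cast; rfl, Int.floor_intCast]

lemma Blk_bound (hd : 1 ≤ d) (φ : ℕ → ℝ) (hN0 : φ 0 = 0) (hm : Monotone φ)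
    (hA : ∀ l m : ℕ, φ (l + m) ≤ φ l + φ m) (lam0 lam : ℝ) (hl : lam0 < lam)
    (hlam0 : Filter.Tendsto (fun n : ℕ => Real.log (ZR d φ n).toReal / n) Filter.atTop
      (nhds lam0)) (ξ : (Fin d → ℝ) → ℝ)
    (hξ : ∀ x : Fin d → ℝ,
      Filter.Tendsto (fun M : ℝ => -Real.log (HRf φ lam (flr M x)).toReal / M)
        Filter.atTop (nhds (ξ x))) (h : Fin d → ℝ) (hh : h ∈ Kset ξ) (n : ℕ) (hn : 0 < n)
    (x : Pt d) :
    Real.exp (inr h (ctR x)) * (TW φ lam (Blk n x)).toReal ≤ 1 := by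
  set a := (TW φ lam (Blk n x)).toReal with ha
  have haT : TW φ lam (Blk n x) = ENNReal.ofReal a :=
    (ENNReal.ofReal_toReal (Blk_ne_top φ lam n x)).symm
  have ha0 : 0 ≤ a := ENNReal.toReal_nonneg
  rcases ha0.eq_or_lt with ha0 | ha0
  · rw [← ha0]; simp
  suffices hs : inr h (ctR x) ≤ -Real.log a by
    calc _ ≤ Real.exp (-Real.log a) * a :=
          mul_le_mul_of_nonneg_right (Real.exp_le_exp.2 hs) ha0.le
      _ = 1 := by rw [Real.exp_neg, Real.exp_log ha0, inv_mul_cancel₀ ha0.ne']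
  by_cases hx : x = 0
  · subst hx
    have hz : inr h (ctR (0 : Pt d)) = 0 := by simp [inr, ctR]
    rw [hz]
    -- a ^ m * c ≤ exp(-lam n m) Z_{nm}
    set c := Real.exp (-PotR φ ([] : List (Pt d)) - lam * ([] : List (Pt d)).length) with hc
    have hc0 : 0 < c := Real.exp_pos _
    have key : ∀ m : ℕ, c * a ^ m ≤ Real.exp (-(lam * (m * n : ℕ))) * (ZR d φ (m * n)).toReal := by
      intro m
      have h1 : ENNReal.ofReal c * (TW φ lam (Blk n (0 : Pt d))) ^ m
          ≤ TW φ lam (PathsN d (m * n)) :=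
        ((mul_le_mul_left (wR_le_TW φ lam _ _ (nil_mem_Sm n (0 : Pt d))) _).trans
          (Sm_pow φ hN0 hm hA lam n 0 m)).trans
          (ENNReal.tsum_mono_subtype (wR φ lam) (fun _ h => ⟨h.1, h.2.1⟩))
      rw [TW_PathsN, haT, ← ENNReal.ofReal_pow ha0.le, ← ENNReal.ofReal_mul hc0.le] at h1
      rw [← ENNReal.ofReal_toReal (ZR_ne_top φ (m * n)),
        ← ENNReal.ofReal_mul (Real.exp_nonneg _)] at h1
      exact (ENNReal.ofReal_le_ofReal_iff (by positivity)).1 h1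
    clear_value c
    have hlim : Tendsto (fun m : ℕ => lam * n - Real.log (ZR d φ (m * n)).toReal / (m * n : ℕ) * n)
        atTop (𝓝 (lam * n - lam0 * n)) := by
      apply Tendsto.const_sub
      apply Tendsto.mul_const
      exact hlam0.comp (tendsto_id.atTop_mul_const' hn)
    have h2 := le_of_tendsto_of_tendsto hlim (tends_aux (Real.log c) (Real.log a) 0) (by
      filter_upwards [eventually_gt_atTop 0] with m hm0
      have hZ : 0 < (ZR d φ (m * n)).toReal :=
        ENNReal.toReal_pos (ZR_pos hd φ _).ne' (ZR_ne_top φ _)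
      have h3 := Real.log_le_log (by positivity) (key m)
      rw [Real.log_mul hc0.ne' (by positivity), Real.log_pow,
        Real.log_mul (Real.exp_pos _).ne' hZ.ne', Real.log_exp] at h3
      have hm' : (0 : ℝ) < m := by exact_mod_cast hm0
      have hn' : (0 : ℝ) < n := by exact_mod_cast hn
      rw [add_zero, le_div_iff₀ hm']
      push_cast at h3 ⊢
      have e : Real.log (ZR d φ (m * n)).toReal / (m * n) * n * m
          = Real.log (ZR d φ (m * n)).toReal := by field_simp
      nlinarith)
    have hn' : (0 : ℝ) < n := by exact_mod_cast hn
    nlinarith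
  · obtain ⟨K, c, hc0, key⟩ := H_lower φ hN0 hm hA lam n x hx
    have hlim : Tendsto (fun m : ℕ => -Real.log (HRf φ lam ((m + K) • x)).toReal / ((m + K : ℕ) : ℝ))
        atTop (𝓝 (ξ (ctR x))) := by
      have := (hξ (ctR x)).comp (tendsto_natCast_atTop_atTop.comp (tendsto_add_atTop_nat K))
      refine this.congr ?_
      intro m
      simp only [Function.comp_apply]
      rw [flr_nat]
    refine (hh (ctR x)).trans ?_
    refine le_of_tendsto_of_tendsto hlim (tends_aux (Real.log c) (Real.log a) K) ?_
    filter_upwards [eventually_gt_atTop 0] with m hm0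
    have h1 := key m
    rw [haT, ← ENNReal.ofReal_pow ha0.le, ← ENNReal.ofReal_mul hc0.le,
      ENNReal.ofReal_le_iff_le_toReal (H_ne_top hd φ lam0 lam hl hlam0 _)] at h1
    have h3 := Real.log_le_log (by positivity) h1
    rw [Real.log_mul hc0.ne' (by positivity), Real.log_pow] at h3
    gcongr

lemma Z_upper (hd : 1 ≤ d) (φ : ℕ → ℝ) (hN0 : φ 0 = 0) (hm : Monotone φ)
    (hA : ∀ l m : ℕ, φ (l + m) ≤ φ l + φ m) (lam0 lam : ℝ) (hl : lam0 < lam)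
    (hlam0 : Filter.Tendsto (fun n : ℕ => Real.log (ZR d φ n).toReal / n) Filter.atTop
      (nhds lam0)) (ξ : (Fin d → ℝ) → ℝ)
    (hξ : ∀ x : Fin d → ℝ,
      Filter.Tendsto (fun M : ℝ => -Real.log (HRf φ lam (flr M x)).toReal / M)
        Filter.atTop (nhds (ξ x))) (h : Fin d → ℝ) (hh : h ∈ Kset ξ) (n : ℕ) (hn : 0 < n) :
    (ZHR d φ h n).toReal ≤ Real.exp (lam * n) * (2 * n + 1) ^ d := by
  set box : Finset (Pt d) := Finset.Icc (fun _ => -(n : ℤ)) (fun _ => (n : ℤ)) with hbox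
  have hcard : (box.card : ℝ) = (2 * n + 1) ^ d := by
    have : box.card = (2 * n + 1) ^ d := by
      rw [hbox, Pi.card_Icc]
      simp only [Int.card_Icc, Finset.prod_const, Finset.card_univ, Fintype.card_fin]
      congr 1
      omega
    rw [this]; push_cast; rfl
  have hcoord : ∀ γ : List (Pt d), IsPath γ → ∀ i, |γ.sum i| ≤ γ.length := by
    intro γ hγ i
    induction γ with
    | nil => simp
    | cons s γ ih =>
      have h1 : |s i| ≤ 1 := by
        rw [← show (∑ i, |s i|) = 1 from hγ s (by simp)]
        exact Finset.single_le_sum (f := fun i => |s i|) (fun i _ => abs_nonneg _)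
          (Finset.mem_univ i)
      have h2 := ih (fun t ht => hγ t (by simp [ht]))
      rw [List.sum_cons, Pi.add_apply, List.length_cons]
      push_cast
      linarith [abs_add_le (s i) (γ.sum i)]
  have hsub : PathsN d n ⊆ ⋃ x ∈ box, Blk n x := by
    rintro γ ⟨h1, h2⟩
    simp only [Set.mem_iUnion]
    refine ⟨disp γ, ?_, h1, h2, rfl⟩
    rw [hbox, Finset.mem_Icc]
    have := fun i => abs_le.1 (hcoord γ h1 i)
    rw [h2] at this
    exact ⟨fun i => (this i).1, fun i => (this i).2⟩
  have hb : ∀ x : Pt d, ∑' γ : Blk n x, wHR φ h (γ : List (Pt d)) ≤ ENNReal.ofReal (Real.exp (lam * n)) := by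
    intro x
    have e : ∑' γ : Blk n x, wHR φ h (γ : List (Pt d)) =
        ENNReal.ofReal (Real.exp (lam * n + inr h (ctR x))) * TW φ lam (Blk n x) := by
      unfold TW
      rw [← ENNReal.tsum_mul_left]
      congr 1
      funext γ
      unfold wHR wR
      rw [← ENNReal.ofReal_mul (Real.exp_nonneg _), ← Real.exp_add, γ.2.2.1, γ.2.2.2]
      congr 2
      ring
    rw [e, ← ENNReal.ofReal_toReal (Blk_ne_top φ lam n x), ← ENNReal.ofReal_mul (Real.exp_nonneg _)]
    apply ENNReal.ofReal_le_ofReal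
    rw [Real.exp_add, mul_assoc]
    exact mul_le_of_le_one_right (Real.exp_nonneg _)
      (Blk_bound hd φ hN0 hm hA lam0 lam hl hlam0 ξ hξ h hh n hn x)
  have h1 : ZHR d φ h n ≤ ENNReal.ofReal (Real.exp (lam * n) * (2 * n + 1) ^ d) :=
    calc ZHR d φ h n ≤ ∑ x ∈ box, ∑' γ : (Blk n x : Set (List (Pt d))), wHR φ h (γ : List (Pt d)) :=
          (ENNReal.tsum_mono_subtype (wHR φ h) hsub).trans (ENNReal.tsum_biUnion_le _ _ _)
      _ ≤ ∑ x ∈ box, ENNReal.ofReal (Real.exp (lam * n)) := Finset.sum_le_sum fun x _ => hb x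
      _ = _ := by
        rw [Finset.sum_const, nsmul_eq_mul, ← hcard, mul_comm,
          ENNReal.ofReal_mul (Real.exp_nonneg _), ENNReal.ofReal_natCast]
  exact ENNReal.toReal_le_of_le_ofReal (by positivity) h1

lemma Z_lower (φ : ℕ → ℝ) (h : Fin d → ℝ) (n : ℕ) : ZR d φ n ≤ ZHR d φ h n := by
  let F : PathsN d n → PathsN d n := fun γ => ⟨γ.1.map (fun s => -s), by
    refine ⟨?_, by simpa using γ.2.2⟩
    intro s hs
    obtain ⟨t, ht, rfl⟩ := List.mem_map.1 hs
    have := γ.2.1 t ht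
    simpa [IsStep] using this⟩
  have hF : Function.Injective F := by
    intro a b hab
    have := congrArg Subtype.val hab
    exact Subtype.ext (List.map_injective_iff.2 neg_injective this)
  have h1 : ∑' γ : PathsN d n, wHR φ h (F γ : List (Pt d)) ≤ ZHR d φ h n :=
    ENNReal.tsum_comp_le_tsum_of_injective hF (fun c : PathsN d n => wHR φ h (c : List (Pt d)))
  have h2 : ZR d φ n + ZR d φ n ≤ ZHR d φ h n + ZHR d φ h n := by
    refine le_trans ?_ (add_le_add_right h1 _)
    unfold ZR ZHR
    rw [← ENNReal.tsum_add, ← ENNReal.tsum_add]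
    apply ENNReal.tsum_le_tsum
    intro γ
    have e : inr h (ctR (disp (F γ : List (Pt d)))) = - inr h (ctR (disp (γ : List (Pt d)))) := by
      have : disp (F γ : List (Pt d)) = - disp (γ : List (Pt d)) := map_neg_sum _
      rw [this]
      simp [inr, ctR]
    unfold wHR
    rw [e, PotR_neg, ← ENNReal.ofReal_add (by positivity) (by positivity),
      ← ENNReal.ofReal_add (by positivity) (by positivity)]
    apply ENNReal.ofReal_le_ofReal
    rw [Real.exp_add, Real.exp_add]
    set t := inr h (ctR (disp (γ : List (Pt d))))
    have hc := Real.one_le_cosh t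
    rw [Real.cosh_eq] at hc
    nlinarith [Real.exp_pos (-PotR φ (γ : List (Pt d)))]
  rw [← two_mul, ← two_mul] at h2
  exact (ENNReal.mul_le_mul_iff_right (by simp) (by simp)).1 h2

lemma Lam_lower (φ : ℕ → ℝ) (hN0 : φ 0 = 0)
    (hA : ∀ l m : ℕ, φ (l + m) ≤ φ l + φ m) (g : Fin d → ℝ) (L : ℝ)
    (hL : Filter.Tendsto (fun n : ℕ => Real.log (ZHR d φ g n).toReal / n) Filter.atTop
        (nhds L)) (i : Fin d) : |g i| - φ 1 ≤ L := by
  obtain ⟨ε, hε, hεg⟩ : ∃ ε : ℤ, |ε| = 1 ∧ g i * ε = |g i| := by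
    rcases le_total 0 (g i) with h | h
    · exact ⟨1, by simp, by simp [abs_of_nonneg h]⟩
    · exact ⟨-1, by simp, by simp [abs_of_nonpos h]⟩
  have hlim := tends_aux (φ 1) (φ 1 - |g i|) 0
  rw [neg_sub] at hlim
  refine le_of_tendsto_of_tendsto hlim hL ?_
  filter_upwards [eventually_gt_atTop 0] with n hn
  have hmem := rep_mem n i ε hε
  have hinr : inr g (ctR (disp (List.replicate n (Pi.single i ε : Pt d)))) = n * |g i| := by
    unfold inr ctR disp
    rw [List.sum_replicate, Finset.sum_eq_single i]
    · simp only [Pi.smul_apply, Pi.single_eq_same, nsmul_eq_mul]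
      push_cast
      rw [← hεg]; ring
    · intro j _ hj
      simp [Pi.single_eq_of_ne hj]
    · simp
  have h1 : ENNReal.ofReal (Real.exp (-(φ 1 * (n + 1)) + n * |g i|)) ≤ ZHR d φ g n := by
    refine le_trans ?_ (ENNReal.le_tsum (f := fun γ : PathsN d n =>
      wHR φ g (γ : List (Pt d))) ⟨_, hmem⟩)
    unfold wHR
    apply ENNReal.ofReal_le_ofReal
    apply Real.exp_le_exp.2
    rw [hinr]
    have := PotR_le φ hN0 hA (List.replicate n (Pi.single i ε : Pt d))
    rw [List.length_replicate] at this
    linarith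
  rw [ENNReal.ofReal_le_iff_le_toReal (ZHR_ne_top φ g n)] at h1
  have h2 := Real.log_le_log (Real.exp_pos _) h1
  rw [Real.log_exp] at h2
  rw [add_zero]
  gcongr
  linarith

lemma abs_le_nrm (u : Fin d → ℝ) (i : Fin d) : |u i| ≤ nrm u := by
  unfold nrm
  rw [← Real.sqrt_sq_eq_abs]
  exact Real.sqrt_le_sqrt (Finset.single_le_sum (f := fun i => u i ^ 2)
    (fun i _ => sq_nonneg _) (Finset.mem_univ i))

lemma nrm_sq (u : Fin d → ℝ) : inr u u = nrm u * nrm u := by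
  unfold nrm inr
  rw [Real.mul_self_sqrt (Finset.sum_nonneg fun i _ => sq_nonneg _)]
  simp [sq]

end SIRWaux

open SIRWaux

/-- attractive case with (SL): `Λ ≡ λ₀` on `K_{λ₀}`; consequently, for `h` in
the interior of `K_{λ₀}`, `Λ_h` vanishes near the origin and the rate function satisfies
`J_h(u) ≥ α‖u‖` near `0` (sub-ballistic behaviour). -/
theorem stmt15 (d : ℕ) (hd : 1 ≤ d) (φ : ℕ → ℝ)
    (hpos : ∀ n, 0 ≤ φ n) (hN0 : φ 0 = 0) (hNmono : Monotone φ)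
    (hA : ∀ l m : ℕ, φ (l + m) ≤ φ l + φ m)
    (hSL : Filter.Tendsto (fun n : ℕ => φ n / n) Filter.atTop (nhds 0))
    (lam0 : ℝ)
    (hlam0 : Filter.Tendsto (fun n : ℕ => Real.log (ZR d φ n).toReal / n) Filter.atTop
      (nhds lam0))
    (ξ : ℝ → (Fin d → ℝ) → ℝ)
    (hξ : ∀ lam : ℝ, lam0 < lam → ∀ x : Fin d → ℝ,
      Filter.Tendsto (fun M : ℝ => -Real.log (HRf φ lam (flr M x)).toReal / M)
        Filter.atTop (nhds (ξ lam x)))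
    (Λ : (Fin d → ℝ) → ℝ)
    (hΛ : ∀ g : Fin d → ℝ,
      Filter.Tendsto (fun n : ℕ => Real.log (ZHR d φ g n).toReal / n) Filter.atTop
        (nhds (Λ g))) :
    (∀ h ∈ ⋂ lam ∈ Set.Ioi lam0, Kset (ξ lam), Λ h = lam0) ∧
    (∀ h ∈ interior (⋂ lam ∈ Set.Ioi lam0, Kset (ξ lam)),
      (∃ r : ℝ, 0 < r ∧ ∀ g : Fin d → ℝ, nrm g < r → Λ (h + g) = Λ h) ∧
      (∃ α : ℝ, 0 < α ∧ ∃ r' : ℝ, 0 < r' ∧ ∀ u : Fin d → ℝ, nrm u < r' →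
        α * nrm u ≤ ⨆ g : Fin d → ℝ, (inr g u - (Λ (h + g) - Λ h)))) := by
  have main : ∀ h ∈ ⋂ lam ∈ Set.Ioi lam0, Kset (ξ lam), Λ h = lam0 := by
    intro h hh
    apply le_antisymm
    · apply le_of_forall_gt_imp_ge_of_dense
      intro lam hl
      have hK : h ∈ Kset (ξ lam) := by
        simp only [Set.mem_iInter] at hh
        exact hh lam hl
      have hlog : Tendsto (fun n : ℕ => lam + d * (Real.log (2 * n + 1) / n)) atTop
          (𝓝 (lam + d * 0)) := by
        apply Tendsto.const_add
        apply Tendsto.const_mul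
        have h1 : Tendsto (fun n : ℕ => Real.log (2 * n + 1) / (2 * n + 1)) atTop (𝓝 0) := by
          have h2 : Tendsto (fun n : ℕ => (2 * n + 1 : ℝ)) atTop atTop :=
            tendsto_atTop_add_const_right _ _
              (tendsto_natCast_atTop_atTop.const_mul_atTop (by norm_num))
          exact (Real.isLittleO_log_id_atTop.tendsto_div_nhds_zero).comp h2
        have h3 : Tendsto (fun n : ℕ => Real.log (2 * n + 1) / (2 * n + 1) * 3) atTop
            (𝓝 (0 * 3)) := h1.mul_const 3
        rw [zero_mul] at h3
        refine squeeze_zero' ?_ ?_ h3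
        · filter_upwards with n
          apply div_nonneg (Real.log_nonneg _) (Nat.cast_nonneg n)
          linarith [(Nat.cast_nonneg n : (0 : ℝ) ≤ n)]
        · filter_upwards [eventually_gt_atTop 0] with n hn
          have hn1 : (1 : ℝ) ≤ n := by exact_mod_cast hn
          have hl0 : 0 ≤ Real.log (2 * n + 1) := Real.log_nonneg (by linarith)
          rw [div_mul_eq_mul_div, div_le_div_iff₀ (by linarith) (by linarith)]
          nlinarith
      rw [mul_zero, add_zero] at hlog
      refine le_of_tendsto_of_tendsto (hΛ h) hlog ?_
      filter_upwards [eventually_gt_atTop 0] with n hn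
      have hn0 : (0 : ℝ) < n := by exact_mod_cast hn
      have hup := Z_upper hd φ hN0 hNmono hA lam0 lam hl hlam0 (ξ lam) (hξ lam hl) h hK n hn
      have hpos' : 0 < (ZHR d φ h n).toReal :=
        ENNReal.toReal_pos ((ZR_pos hd φ n).trans_le (Z_lower φ h n)).ne' (ZHR_ne_top φ h n)
      have h4 := Real.log_le_log hpos' hup
      rw [Real.log_mul (Real.exp_pos _).ne' (by positivity), Real.log_exp, Real.log_pow] at h4
      rw [div_le_iff₀ hn0]
      have e : (lam + d * (Real.log (2 * n + 1) / n)) * n = lam * n + d * Real.log (2 * n + 1) := by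
        field_simp
      rw [e]
      exact h4
    · refine le_of_tendsto_of_tendsto hlam0 (hΛ h) ?_
      filter_upwards with n
      have hZ : 0 < (ZR d φ n).toReal := ENNReal.toReal_pos (ZR_pos hd φ n).ne' (ZR_ne_top φ n)
      have := ENNReal.toReal_mono (ZHR_ne_top φ h n) (Z_lower φ h n)
      gcongr
  refine ⟨main, ?_⟩
  intro h hh
  have hfirst : ∃ r : ℝ, 0 < r ∧ ∀ g : Fin d → ℝ, nrm g < r → Λ (h + g) = Λ h := by
    obtain ⟨r, hr, hb⟩ := Metric.isOpen_iff.1 isOpen_interior h hh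
    refine ⟨r, hr, fun g hg => ?_⟩
    rw [main h (interior_subset hh)]
    apply main
    apply interior_subset
    apply hb
    rw [Metric.mem_ball, dist_eq_norm, add_sub_cancel_left, pi_norm_lt_iff hr]
    intro i
    exact (abs_le_nrm g i).trans_lt hg
  refine ⟨hfirst, ?_⟩
  obtain ⟨r, hr, hflat⟩ := hfirst
  have hd0 : (0 : ℝ) < d := by exact_mod_cast hd
  refine ⟨r / 2, by positivity, 1 / d, by positivity, fun u hu => ?_⟩
  have hbdd : BddAbove (Set.range fun g : Fin d → ℝ => inr g u - (Λ (h + g) - Λ h)) := by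
    refine ⟨φ 1 + nrm h + Λ h, ?_⟩
    rintro _ ⟨g, rfl⟩
    have hg : ∀ i, |g i| ≤ Λ (h + g) + φ 1 + nrm h := by
      intro i
      have h1 := Lam_lower φ hN0 hA (h + g) _ (hΛ (h + g)) i
      have h2 := abs_le_nrm h i
      have h3 : |g i| ≤ |(h + g) i| + |h i| := by
        have := abs_sub (( h + g) i) (h i)
        simpa using this
      linarith
    have hC : 0 ≤ Λ (h + g) + φ 1 + nrm h := (abs_nonneg _).trans (hg ⟨0, hd⟩)
    have : inr g u ≤ Λ (h + g) + φ 1 + nrm h := by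
      calc inr g u ≤ ∑ i : Fin d, (Λ (h + g) + φ 1 + nrm h) * (1 / d) := by
            apply Finset.sum_le_sum
            intro i _
            calc g i * u i ≤ |g i * u i| := le_abs_self _
              _ = |g i| * |u i| := abs_mul _ _
              _ ≤ _ := mul_le_mul (hg i) ((abs_le_nrm u i).trans hu.le) (abs_nonneg _) hC
        _ = _ := by
            rw [Finset.sum_const, Finset.card_univ, Fintype.card_fin, nsmul_eq_mul]
            field_simp
    linarith
  have hu0 : 0 ≤ nrm u := Real.sqrt_nonneg _
  rcases hu0.eq_or_lt with h0 | h0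
  · rw [← h0, mul_zero]
    refine le_trans ?_ (le_ciSup hbdd 0)
    simp [inr]
  · refine le_trans ?_ (le_ciSup hbdd ((r / 2 / nrm u) • u))
    have hs : inr ((r / 2 / nrm u) • u) u = r / 2 * nrm u := by
      have : inr ((r / 2 / nrm u) • u) u = (r / 2 / nrm u) * inr u u := by
        simp [inr, Finset.mul_sum, mul_assoc]
      rw [this, nrm_sq]
      field_simp
    have hn : nrm ((r / 2 / nrm u) • u) = r / 2 := by
      have h1 : 0 ≤ nrm ((r / 2 / nrm u) • u) := Real.sqrt_nonneg _
      have h2 : nrm ((r / 2 / nrm u) • u) * nrm ((r / 2 / nrm u) • u) = r / 2 * (r / 2) := by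
        rw [← nrm_sq]
        have : inr ((r / 2 / nrm u) • u) ((r / 2 / nrm u) • u)
            = (r / 2 / nrm u) * ((r / 2 / nrm u) * inr u u) := by
          simp only [inr, Finset.mul_sum, Pi.smul_apply, smul_eq_mul]
          exact Finset.sum_congr rfl fun i _ => by ring
        rw [this, nrm_sq]
        field_simp
      nlinarith [mul_self_inj h1 (by positivity : 0 ≤ r / 2) |>.1 h2]
    rw [hs, hflat _ (by rw [hn]; linarith)]
    simp
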